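/- arXiv:2005.01635 — 2 statements merged into one kernel-verified Lean document; each statement's English description precedes it below -/
import Mathlib

section
/- For every integer n ≥ 10, the graph Ψ_n = Cay(D_n, {τ_0, τ_1, τ_3}) is girth-regular with signature (3, 4, 5); that is, every vertex of Ψ_n is incident to exactly one edge lying on exactly 3 six-cycles, one edge lying on exactly 4 six-cycles, and one edge lying on exactly 5 six-cycles. -/
/-- The Cayley graph of a group on a (symmetric) connection set `S`:
distinct `g, h` are adjacent iff `g * h⁻¹ ∈ S`. -/
def cayley {G : Type*} [Group G] (S : Set G) : SimpleGraph G :=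
  SimpleGraph.fromRel (fun x y => x * y⁻¹ ∈ S)

/-- In the dihedral group `D_n = ⟨ρ, τ⟩`, the element `τ_i = ρ^i * τ`. -/
def dihTau {n : ℕ} (i : ℕ) : DihedralGroup n :=
  (DihedralGroup.r 1) ^ i * DihedralGroup.sr 0

/-- The graph `Ψ_n = Cay(D_n, {τ_0, τ_1, τ_3})`. -/
def psiGraph (n : ℕ) : SimpleGraph (DihedralGroup n) :=
  cayley ({dihTau 0, dihTau 1, dihTau 3} : Set (DihedralGroup n))

/-- The number of cycles of length 6 in `G` (identified with their edge sets)
that contain the edge `e`. -/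
noncomputable def sixCycleCount {V : Type*} (G : SimpleGraph V) (e : Sym2 V) : ℕ :=
  Set.ncard {s : Set (Sym2 V) |
    (∃ (v : V) (w : G.Walk v v), w.IsCycle ∧ w.length = 6 ∧ s = {e' | e' ∈ w.edges}) ∧ e ∈ s}

open DihedralGroup

/-- The edge set of the closed walk of length six through the vertices
`r a, sr b, r c, sr d, r e, sr f`. -/
def hexagon {n : ℕ} (a b c d e f : ZMod n) : Set (Sym2 (DihedralGroup n)) :=
  {s(r a, sr b), s(r c, sr b), s(r c, sr d), s(r e, sr d), s(r e, sr f), s(r a, sr f)}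

lemma hexagon_rotate {n : ℕ} (a b c d e f : ZMod n) :
    hexagon a b c d e f = hexagon c d e f a b := by
  ext x; simp only [hexagon, Set.mem_insert_iff, Set.mem_singleton_iff]; tauto

lemma hexagon_reflect {n : ℕ} (a b c d e f : ZMod n) :
    hexagon a b c d e f = hexagon a f e d c b := by
  ext x; simp only [hexagon, Set.mem_insert_iff, Set.mem_singleton_iff]; tauto

lemma mem_hexagon_iff {n : ℕ} (a b c d e f x y : ZMod n) :
    s(r x, sr y) ∈ hexagon a b c d e f ↔
      (x = a ∧ y = b) ∨ (x = c ∧ y = b) ∨ (x = c ∧ y = d) ∨ (x = e ∧ y = d) ∨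
        (x = e ∧ y = f) ∨ (x = a ∧ y = f) := by
  simp [hexagon]

/-- The hexagon whose edges have the labels `0, 1, 3, 0, 1, 3`, starting at `r i`. -/
def hexagonA {n : ℕ} (i : ZMod n) : Set (Sym2 (DihedralGroup n)) :=
  hexagon i i (i + 1) (i - 2) (i - 2) (i - 3)

/-- The hexagon whose edges have the labels `0, 1, 0, 1, 3, 1`, starting at `r i`. -/
def hexagonB {n : ℕ} (i : ZMod n) : Set (Sym2 (DihedralGroup n)) :=
  hexagon i i (i + 1) (i + 1) (i + 2) (i - 1)

lemma natCast_zmod_ne_zero {n k : ℕ} (hk : 0 < k) (hkn : k < n) : (k : ZMod n) ≠ 0 := by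
  rw [Ne, ZMod.natCast_eq_zero_iff]
  exact Nat.not_dvd_of_pos_of_lt hk hkn

lemma zmod_small_ne_zero {n : ℕ} (hn : 10 ≤ n) :
    (1 : ZMod n) ≠ 0 ∧ (2 : ZMod n) ≠ 0 ∧ (3 : ZMod n) ≠ 0 ∧ (4 : ZMod n) ≠ 0 := by
  refine ⟨?_, ?_, ?_, ?_⟩
  · exact_mod_cast natCast_zmod_ne_zero (n := n) (k := 1) (by omega) (by omega)
  · exact_mod_cast natCast_zmod_ne_zero (n := n) (k := 2) (by omega) (by omega)
  · exact_mod_cast natCast_zmod_ne_zero (n := n) (k := 3) (by omega) (by omega)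
  · exact_mod_cast natCast_zmod_ne_zero (n := n) (k := 4) (by omega) (by omega)

lemma hexagonA_inj {n : ℕ} (hn : 10 ≤ n) (i j : ZMod n) :
    hexagonA i = hexagonA j ↔ i = j := by
  obtain ⟨h1, h2, h3, h4⟩ := zmod_small_ne_zero hn
  refine ⟨fun h => ?_, fun h => h ▸ rfl⟩
  have m1 : s(r i, sr i) ∈ hexagonA j := h ▸ (mem_hexagon_iff ..).2 (by simp)
  have m2 : s(r (i - 2), sr (i - 2)) ∈ hexagonA j := h ▸ (mem_hexagon_iff ..).2 (by simp)
  rw [hexagonA, mem_hexagon_iff] at m1 m2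
  grind

lemma hexagonB_inj {n : ℕ} (hn : 10 ≤ n) (i j : ZMod n) :
    hexagonB i = hexagonB j ↔ i = j := by
  obtain ⟨h1, h2, h3, h4⟩ := zmod_small_ne_zero hn
  refine ⟨fun h => ?_, fun h => h ▸ rfl⟩
  have m1 : s(r (i + 2), sr (i - 1)) ∈ hexagonB j := h ▸ (mem_hexagon_iff ..).2 (by simp)
  rw [hexagonB, mem_hexagon_iff] at m1
  grind

lemma hexagonA_ne_hexagonB {n : ℕ} (hn : 10 ≤ n) (i j : ZMod n) :
    hexagonA i ≠ hexagonB j := by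
  obtain ⟨h1, h2, h3, h4⟩ := zmod_small_ne_zero hn
  intro h
  have m1 : s(r (i + 1), sr (i - 2)) ∈ hexagonB j := h ▸ (mem_hexagon_iff ..).2 (by simp)
  have m2 : s(r i, sr (i - 3)) ∈ hexagonB j := h ▸ (mem_hexagon_iff ..).2 (by simp)
  rw [hexagonB, mem_hexagon_iff] at m1 m2
  grind

lemma dihTau_eq {n : ℕ} (k : ℕ) : (dihTau k : DihedralGroup n) = sr (-k : ZMod n) := by
  simp [dihTau]

lemma psiGraph_adj_r_sr {n : ℕ} (i j : ZMod n) :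
    (psiGraph n).Adj (r i) (sr j) ↔ i - j = 0 ∨ i - j = 1 ∨ i - j = 3 := by
  simp only [psiGraph, cayley, SimpleGraph.fromRel_adj, dihTau_eq, Set.mem_insert_iff,
    Set.mem_singleton_iff, inv_r, inv_sr, r_mul_sr, sr_mul_r, sr.injEq]
  grind

lemma psiGraph_not_adj_r_r {n : ℕ} (i j : ZMod n) : ¬(psiGraph n).Adj (r i) (r j) := by
  simp [psiGraph, cayley, dihTau_eq]

lemma psiGraph_not_adj_sr_sr {n : ℕ} (i j : ZMod n) : ¬(psiGraph n).Adj (sr i) (sr j) := by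
  simp [psiGraph, cayley, dihTau_eq]

lemma exists_isCycle_six_iff {V : Type*} (G : SimpleGraph V) (s : Set (Sym2 V)) :
    (∃ (v : V) (w : G.Walk v v), w.IsCycle ∧ w.length = 6 ∧ s = {e' | e' ∈ w.edges}) ↔
      ∃ a b c d e f : V, [a, b, c, d, e, f].Nodup ∧ G.Adj a b ∧ G.Adj b c ∧ G.Adj c d ∧
        G.Adj d e ∧ G.Adj e f ∧ G.Adj f a ∧
        s = {s(a, b), s(b, c), s(c, d), s(d, e), s(e, f), s(f, a)} := by
  constructor
  · rintro ⟨a, w, hw, hl, rfl⟩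
    have hnd := hw.support_nodup
    match w, hl with
    | .cons (v := b) h1 (.cons (v := c) h2 (.cons (v := d) h3 (.cons (v := e) h4
        (.cons (v := f) h5 (.cons h6 .nil))))), _ =>
      refine ⟨a, b, c, d, e, f, ?_, h1, h2, h3, h4, h5, h6, ?_⟩
      · simp only [SimpleGraph.Walk.support_cons, SimpleGraph.Walk.support_nil,
          List.tail_cons] at hnd
        exact (List.perm_append_comm (l₁ := [b, c, d, e, f]) (l₂ := [a])).nodup_iff.1 hnd
      · ext x
        simp
  · rintro ⟨a, b, c, d, e, f, hnd, h1, h2, h3, h4, h5, h6, rfl⟩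
    refine ⟨a, .cons h1 (.cons h2 (.cons h3 (.cons h4 (.cons h5 (.cons h6 .nil))))), ?_, rfl, ?_⟩
    · simp only [List.nodup_cons, List.mem_cons, List.not_mem_nil, not_or] at hnd
      rw [SimpleGraph.Walk.cons_isCycle_iff]
      simp [SimpleGraph.Walk.cons_isPath_iff]
      grind
    · ext x
      simp

lemma labels_of_sum_eq : ∀ l₁ ∈ ({0, 1, 3} : Finset ℕ), ∀ l₂ ∈ ({0, 1, 3} : Finset ℕ),
    ∀ l₃ ∈ ({0, 1, 3} : Finset ℕ), ∀ l₄ ∈ ({0, 1, 3} : Finset ℕ),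
    ∀ l₅ ∈ ({0, 1, 3} : Finset ℕ), ∀ l₆ ∈ ({0, 1, 3} : Finset ℕ),
    l₁ ≠ l₂ → l₂ ≠ l₃ → l₃ ≠ l₄ → l₄ ≠ l₅ → l₅ ≠ l₆ → l₆ ≠ l₁ →
    l₁ + l₃ + l₅ = l₂ + l₄ + l₆ →
    [l₁, l₂, l₃, l₄, l₅, l₆] ∈
      [[0, 1, 3, 0, 1, 3], [3, 0, 1, 3, 0, 1], [1, 3, 0, 1, 3, 0],
       [3, 1, 0, 3, 1, 0], [1, 0, 3, 1, 0, 3], [0, 3, 1, 0, 3, 1],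
       [0, 1, 0, 1, 3, 1], [0, 1, 3, 1, 0, 1], [3, 1, 0, 1, 0, 1],
       [1, 3, 1, 0, 1, 0], [1, 0, 1, 3, 1, 0], [1, 0, 1, 0, 1, 3]] := by
  decide

lemma exists_label {n : ℕ} {x y : ZMod n} (h : x - y = 0 ∨ x - y = 1 ∨ x - y = 3) :
    ∃ l ∈ ({0, 1, 3} : Finset ℕ), y = x - l := by
  rcases h with h | h | h
  · exact ⟨0, by simp, by push_cast; linear_combination -h⟩
  · exact ⟨1, by simp, by push_cast; linear_combination -h⟩
  · exact ⟨3, by simp, by push_cast; linear_combination -h⟩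

lemma hexagon_eq_A_or_B {n : ℕ} (hn : 10 ≤ n) {a b c d e f : ZMod n}
    (hac : a ≠ c) (hce : c ≠ e) (hea : e ≠ a) (hbd : b ≠ d) (hdf : d ≠ f) (hfb : f ≠ b)
    (hab : a - b = 0 ∨ a - b = 1 ∨ a - b = 3) (hcb : c - b = 0 ∨ c - b = 1 ∨ c - b = 3)
    (hcd : c - d = 0 ∨ c - d = 1 ∨ c - d = 3) (hed : e - d = 0 ∨ e - d = 1 ∨ e - d = 3)
    (hef : e - f = 0 ∨ e - f = 1 ∨ e - f = 3) (haf : a - f = 0 ∨ a - f = 1 ∨ a - f = 3) :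
    ∃ i, hexagon a b c d e f = hexagonA i ∨ hexagon a b c d e f = hexagonB i := by
  obtain ⟨l₁, m₁, h₁⟩ := exists_label hab
  obtain ⟨l₂, m₂, h₂⟩ := exists_label hcb
  obtain ⟨l₃, m₃, h₃⟩ := exists_label hcd
  obtain ⟨l₄, m₄, h₄⟩ := exists_label hed
  obtain ⟨l₅, m₅, h₅⟩ := exists_label hef
  obtain ⟨l₆, m₆, h₆⟩ := exists_label haf
  have le3 : ∀ l ∈ ({0, 1, 3} : Finset ℕ), l ≤ 3 := by decide
  have hsum : l₁ + l₃ + l₅ = l₂ + l₄ + l₆ := by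
    have hz : ((l₁ + l₃ + l₅ : ℕ) : ZMod n) = ((l₂ + l₄ + l₆ : ℕ) : ZMod n) := by
      push_cast
      linear_combination h₁ - h₂ + h₃ - h₄ + h₅ - h₆
    have := le3 _ m₁; have := le3 _ m₂; have := le3 _ m₃
    have := le3 _ m₄; have := le3 _ m₅; have := le3 _ m₆
    rwa [ZMod.natCast_eq_natCast_iff', Nat.mod_eq_of_lt (by omega),
      Nat.mod_eq_of_lt (by omega)] at hz
  have key := labels_of_sum_eq l₁ m₁ l₂ m₂ l₃ m₃ l₄ m₄ l₅ m₅ l₆ m₆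
    (by rintro rfl; apply hac; linear_combination h₂ - h₁)
    (by rintro rfl; apply hbd; linear_combination h₂ - h₃)
    (by rintro rfl; apply hce; linear_combination h₄ - h₃)
    (by rintro rfl; apply hdf; linear_combination h₄ - h₅)
    (by rintro rfl; apply hea; linear_combination h₆ - h₅)
    (by rintro rfl; apply hfb; linear_combination h₆ - h₁) hsum
  simp only [List.mem_cons, List.cons.injEq, List.not_mem_nil, or_false, and_true] at key
  rcases key with h | h | h | h | h | h | h | h | h | h | h | h <;>
    obtain ⟨rfl, rfl, rfl, rfl, rfl, rfl⟩ := h <;>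
    push_cast at h₁ h₂ h₃ h₄ h₅ h₆
  · refine ⟨a, .inl ?_⟩
    unfold hexagonA; congr 1 <;> grind
  · refine ⟨a - 1, .inl ?_⟩
    rw [hexagon_rotate, hexagon_rotate]
    unfold hexagonA; congr 1 <;> grind
  · refine ⟨a + 2, .inl ?_⟩
    rw [hexagon_rotate]
    unfold hexagonA; congr 1 <;> grind
  · refine ⟨a, .inl ?_⟩
    rw [hexagon_reflect]
    unfold hexagonA; congr 1 <;> grind
  · refine ⟨a - 1, .inl ?_⟩
    rw [hexagon_reflect, hexagon_rotate, hexagon_rotate]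
    unfold hexagonA; congr 1 <;> grind
  · refine ⟨a + 2, .inl ?_⟩
    rw [hexagon_reflect, hexagon_rotate]
    unfold hexagonA; congr 1 <;> grind
  · refine ⟨a, .inr ?_⟩
    unfold hexagonB; congr 1 <;> grind
  · refine ⟨a - 1, .inr ?_⟩
    rw [hexagon_rotate, hexagon_rotate]
    unfold hexagonB; congr 1 <;> grind
  · refine ⟨a - 2, .inr ?_⟩
    rw [hexagon_rotate]
    unfold hexagonB; congr 1 <;> grind
  · refine ⟨a, .inr ?_⟩
    rw [hexagon_reflect]
    unfold hexagonB; congr 1 <;> grind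
  · refine ⟨a - 1, .inr ?_⟩
    rw [hexagon_reflect, hexagon_rotate, hexagon_rotate]
    unfold hexagonB; congr 1 <;> grind
  · refine ⟨a - 2, .inr ?_⟩
    rw [hexagon_reflect, hexagon_rotate]
    unfold hexagonB; congr 1 <;> grind

lemma exists_isCycle_of_hexagon {n : ℕ} {a b c d e f : ZMod n}
    (hac : a ≠ c) (hce : c ≠ e) (hea : e ≠ a) (hbd : b ≠ d) (hdf : d ≠ f) (hfb : f ≠ b)
    (hab : a - b = 0 ∨ a - b = 1 ∨ a - b = 3) (hcb : c - b = 0 ∨ c - b = 1 ∨ c - b = 3)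
    (hcd : c - d = 0 ∨ c - d = 1 ∨ c - d = 3) (hed : e - d = 0 ∨ e - d = 1 ∨ e - d = 3)
    (hef : e - f = 0 ∨ e - f = 1 ∨ e - f = 3) (haf : a - f = 0 ∨ a - f = 1 ∨ a - f = 3) :
    ∃ (v : DihedralGroup n) (w : (psiGraph n).Walk v v), w.IsCycle ∧ w.length = 6 ∧
      hexagon a b c d e f = {e' | e' ∈ w.edges} := by
  rw [exists_isCycle_six_iff]
  refine ⟨r a, sr b, r c, sr d, r e, sr f, ?_, (psiGraph_adj_r_sr ..).2 hab,
    ((psiGraph_adj_r_sr ..).2 hcb).symm, (psiGraph_adj_r_sr ..).2 hcd,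
    ((psiGraph_adj_r_sr ..).2 hed).symm, (psiGraph_adj_r_sr ..).2 hef,
    ((psiGraph_adj_r_sr ..).2 haf).symm, ?_⟩
  · simp [hac, hce, hea.symm, hbd, hdf, hfb.symm]
  · rw [hexagon, Sym2.eq_swap (a := sr b), Sym2.eq_swap (a := sr d), Sym2.eq_swap (a := sr f)]

/-- The six-cycles of `Ψ_n` are the translates of two hexagons. -/
lemma isCycle_six_iff {n : ℕ} (hn : 10 ≤ n) (s : Set (Sym2 (DihedralGroup n))) :
    (∃ (v : DihedralGroup n) (w : (psiGraph n).Walk v v), w.IsCycle ∧ w.length = 6 ∧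
      s = {e' | e' ∈ w.edges}) ↔ ∃ i, s = hexagonA i ∨ s = hexagonB i := by
  constructor
  · rw [exists_isCycle_six_iff]
    rintro ⟨a, b, c, d, e, f, hnd, h1, h2, h3, h4, h5, h6, rfl⟩
    rcases a with a | a <;> rcases b with b | b <;>
      first
        | exact absurd h1 (psiGraph_not_adj_r_r _ _)
        | exact absurd h1 (psiGraph_not_adj_sr_sr _ _)
        | skip
    all_goals rcases c with c | c <;>
      first
        | exact absurd h2 (psiGraph_not_adj_r_r _ _)
        | exact absurd h2 (psiGraph_not_adj_sr_sr _ _)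
        | skip
    all_goals rcases d with d | d <;>
      first
        | exact absurd h3 (psiGraph_not_adj_r_r _ _)
        | exact absurd h3 (psiGraph_not_adj_sr_sr _ _)
        | skip
    all_goals rcases e with e | e <;>
      first
        | exact absurd h4 (psiGraph_not_adj_r_r _ _)
        | exact absurd h4 (psiGraph_not_adj_sr_sr _ _)
        | skip
    all_goals rcases f with f | f <;>
      first
        | exact absurd h5 (psiGraph_not_adj_r_r _ _)
        | exact absurd h5 (psiGraph_not_adj_sr_sr _ _)
        | skip
    · simp only [List.nodup_cons, List.mem_cons, List.not_mem_nil, r.injEq, sr.injEq,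
        reduceCtorEq, or_false, false_or, not_or, not_false_eq_true, List.nodup_nil,
        and_true] at hnd
      obtain ⟨⟨hac, hae⟩, ⟨hbd, hbf⟩, hce, hdf⟩ := hnd
      rw [Sym2.eq_swap (a := sr b), Sym2.eq_swap (a := sr d), Sym2.eq_swap (a := sr f)]
      rw [SimpleGraph.adj_comm] at h2 h4 h6
      rw [psiGraph_adj_r_sr] at h1 h2 h3 h4 h5 h6
      exact hexagon_eq_A_or_B hn hac hce (Ne.symm hae) hbd hdf (Ne.symm hbf)
        h1 h2 h3 h4 h5 h6
    · simp only [List.nodup_cons, List.mem_cons, List.not_mem_nil, r.injEq, sr.injEq,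
        reduceCtorEq, or_false, false_or, not_or, not_false_eq_true, List.nodup_nil,
        and_true] at hnd
      obtain ⟨⟨hac, hae⟩, ⟨hbd, hbf⟩, hce, hdf⟩ := hnd
      rw [Sym2.eq_swap (a := sr a), Sym2.eq_swap (a := sr c), Sym2.eq_swap (a := sr e)]
      rw [SimpleGraph.adj_comm] at h1 h3 h5
      rw [psiGraph_adj_r_sr] at h1 h2 h3 h4 h5 h6
      have hs : ({s(r b, sr a), s(r b, sr c), s(r d, sr c), s(r d, sr e), s(r f, sr e),
          s(r f, sr a)} : Set (Sym2 (DihedralGroup n))) = hexagon b c d e f a := by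
        clear h1 h2 h3 h4 h5 h6
        ext x; simp only [hexagon, Set.mem_insert_iff, Set.mem_singleton_iff]; tauto
      rw [hs]
      exact hexagon_eq_A_or_B hn hbd hdf (Ne.symm hbf) hce (Ne.symm hae) hac
        h2 h3 h4 h5 h6 h1
  · obtain ⟨h1, h2, h3, -⟩ := zmod_small_ne_zero hn
    rintro ⟨i, rfl | rfl⟩
    · refine exists_isCycle_of_hexagon
        (fun h => h1 (by linear_combination -h)) (fun h => h3 (by linear_combination h))
        (fun h => h2 (by linear_combination -h)) (fun h => h2 (by linear_combination h))
        (fun h => h1 (by linear_combination h)) (fun h => h3 (by linear_combination -h))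
        ?_ ?_ ?_ ?_ ?_ ?_ <;> grind
    · refine exists_isCycle_of_hexagon
        (fun h => h1 (by linear_combination -h)) (fun h => h1 (by linear_combination -h))
        (fun h => h2 (by linear_combination h)) (fun h => h1 (by linear_combination -h))
        (fun h => h2 (by linear_combination h)) (fun h => h1 (by linear_combination -h))
        ?_ ?_ ?_ ?_ ?_ ?_ <;> grind

lemma sixCycleCount_eq {n : ℕ} (hn : 10 ≤ n) (x y : ZMod n) :
    sixCycleCount (psiGraph n) s(r x, sr y) =
      {i : ZMod n | s(r x, sr y) ∈ hexagonA i}.ncard +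
      {i : ZMod n | s(r x, sr y) ∈ hexagonB i}.ncard := by
  have : NeZero n := ⟨by omega⟩
  rw [← Set.ncard_image_of_injective _ (fun i j h => (hexagonA_inj hn i j).1 h),
    ← Set.ncard_image_of_injective {i : ZMod n | s(r x, sr y) ∈ hexagonB i}
      (fun i j h => (hexagonB_inj hn i j).1 h),
    ← Set.ncard_union_eq _ (Set.toFinite _) (Set.toFinite _), sixCycleCount]
  · congr 1
    ext s
    simp only [isCycle_six_iff hn, Set.mem_ofPred_eq, Set.mem_union, Set.mem_image]
    grind
  · rw [Set.disjoint_left]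
    rintro _ ⟨i, -, rfl⟩ ⟨j, -, h⟩
    exact hexagonA_ne_hexagonB hn i j h.symm

lemma sixCycleCount_label_zero {n : ℕ} (hn : 10 ≤ n) (x y : ZMod n) (h : x - y = 0) :
    sixCycleCount (psiGraph n) s(r x, sr y) = 4 := by
  obtain ⟨h1, h2, h3, h4⟩ := zmod_small_ne_zero hn
  have hA : {i : ZMod n | s(r x, sr y) ∈ hexagonA i} = {x, x + 2} := by
    ext i
    simp only [hexagonA, mem_hexagon_iff, Set.mem_ofPred_eq, Set.mem_insert_iff,
      Set.mem_singleton_iff]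
    grind
  have hB : {i : ZMod n | s(r x, sr y) ∈ hexagonB i} = {x, x - 1} := by
    ext i
    simp only [hexagonB, mem_hexagon_iff, Set.mem_ofPred_eq, Set.mem_insert_iff,
      Set.mem_singleton_iff]
    grind
  rw [sixCycleCount_eq hn, hA, hB, Set.ncard_pair (by grind), Set.ncard_pair (by grind)]

lemma sixCycleCount_label_one {n : ℕ} (hn : 10 ≤ n) (x y : ZMod n) (h : x - y = 1) :
    sixCycleCount (psiGraph n) s(r x, sr y) = 5 := by
  obtain ⟨h1, h2, h3, h4⟩ := zmod_small_ne_zero hn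
  have hA : {i : ZMod n | s(r x, sr y) ∈ hexagonA i} = {x - 1, x + 2} := by
    ext i
    simp only [hexagonA, mem_hexagon_iff, Set.mem_ofPred_eq, Set.mem_insert_iff,
      Set.mem_singleton_iff]
    grind
  have hB : {i : ZMod n | s(r x, sr y) ∈ hexagonB i} = {x, x - 1, x - 2} := by
    ext i
    simp only [hexagonB, mem_hexagon_iff, Set.mem_ofPred_eq, Set.mem_insert_iff,
      Set.mem_singleton_iff]
    grind
  rw [sixCycleCount_eq hn, hA, hB, Set.ncard_pair (by grind),
    Set.ncard_eq_three.2 ⟨x, x - 1, x - 2, by grind, by grind, by grind, rfl⟩]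

lemma sixCycleCount_label_three {n : ℕ} (hn : 10 ≤ n) (x y : ZMod n) (h : x - y = 3) :
    sixCycleCount (psiGraph n) s(r x, sr y) = 3 := by
  obtain ⟨h1, h2, h3, h4⟩ := zmod_small_ne_zero hn
  have hA : {i : ZMod n | s(r x, sr y) ∈ hexagonA i} = {x - 1, x} := by
    ext i
    simp only [hexagonA, mem_hexagon_iff, Set.mem_ofPred_eq, Set.mem_insert_iff,
      Set.mem_singleton_iff]
    grind
  have hB : {i : ZMod n | s(r x, sr y) ∈ hexagonB i} = {x - 2} := by
    ext i
    simp only [hexagonB, mem_hexagon_iff, Set.mem_ofPred_eq, Set.mem_singleton_iff]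
    grind
  rw [sixCycleCount_eq hn, hA, hB, Set.ncard_pair (by grind), Set.ncard_singleton]

lemma ncard_incident_eq_one {n k : ℕ} (l : ZMod n)
    (hl : l = 0 ∨ l = 1 ∨ l = 3)
    (hk : ∀ x y : ZMod n, (psiGraph n).Adj (r x) (sr y) →
      (sixCycleCount (psiGraph n) s(r x, sr y) = k ↔ x - y = l))
    (v : DihedralGroup n) :
    Set.ncard {e ∈ (psiGraph n).incidenceSet v | sixCycleCount (psiGraph n) e = k} = 1 := by
  have adj (x y : ZMod n) (h : x - y = l) : (psiGraph n).Adj (r x) (sr y) :=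
    (psiGraph_adj_r_sr x y).2 (h ▸ hl)
  rw [Set.ncard_eq_one]
  rcases v with i | i
  · refine ⟨s(r i, sr (i - l)), Set.ext fun e => ⟨?_, ?_⟩⟩
    · rintro ⟨⟨he, hv⟩, hc⟩
      obtain ⟨w, rfl⟩ := hv
      rcases w with j | j
      · exact absurd he (psiGraph_not_adj_r_r i j)
      · have := (hk i j he).1 hc
        rw [Set.mem_singleton_iff, ← this, sub_sub_cancel]
    · rintro rfl
      have h := adj i (i - l) (by ring)
      exact ⟨⟨h, Sym2.mem_mk_left _ _⟩, (hk _ _ h).2 (by ring)⟩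
  · refine ⟨s(r (i + l), sr i), Set.ext fun e => ⟨?_, ?_⟩⟩
    · rintro ⟨⟨he, hv⟩, hc⟩
      obtain ⟨w, rfl⟩ := hv
      rcases w with j | j
      · rw [Sym2.eq_swap] at hc ⊢
        have := (hk j i (SimpleGraph.Adj.symm he)).1 hc
        rw [Set.mem_singleton_iff, ← this, add_sub_cancel]
      · exact absurd he (psiGraph_not_adj_sr_sr i j)
    · rintro rfl
      have h := adj (i + l) i (by ring)
      exact ⟨⟨h, Sym2.mem_mk_right _ _⟩, (hk _ _ h).2 (by ring)⟩

theorem psi_signature_three_four_five (n : ℕ) (hn : 10 ≤ n) :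
    ∀ v : DihedralGroup n,
      Set.ncard {e ∈ (psiGraph n).incidenceSet v | sixCycleCount (psiGraph n) e = 3} = 1 ∧
      Set.ncard {e ∈ (psiGraph n).incidenceSet v | sixCycleCount (psiGraph n) e = 4} = 1 ∧
      Set.ncard {e ∈ (psiGraph n).incidenceSet v | sixCycleCount (psiGraph n) e = 5} = 1 := by
  intro v
  obtain ⟨h1, h2, h3, -⟩ := zmod_small_ne_zero hn
  have count (x y : ZMod n) (h : (psiGraph n).Adj (r x) (sr y)) :
      (sixCycleCount (psiGraph n) s(r x, sr y) = 4 ∧ x - y = 0) ∨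
      (sixCycleCount (psiGraph n) s(r x, sr y) = 5 ∧ x - y = 1) ∨
      (sixCycleCount (psiGraph n) s(r x, sr y) = 3 ∧ x - y = 3) := by
    rcases (psiGraph_adj_r_sr x y).1 h with h | h | h
    · exact .inl ⟨sixCycleCount_label_zero hn x y h, h⟩
    · exact .inr (.inl ⟨sixCycleCount_label_one hn x y h, h⟩)
    · exact .inr (.inr ⟨sixCycleCount_label_three hn x y h, h⟩)
  refine ⟨ncard_incident_eq_one 3 (by simp) (fun x y h => ?_) v,
    ncard_incident_eq_one 0 (by simp) (fun x y h => ?_) v,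
    ncard_incident_eq_one 1 (by simp) (fun x y h => ?_) v⟩ <;>
  · have := count x y h
    grind
end

section
/- The graph Ψ_8 = Cay(D_8, {τ_0, τ_1, τ_3}) is isomorphic to the generalized Petersen graph GP(8, 3) (the Möbius–Kantor graph). -/
/-- The generalized Petersen graph `GP(n, k)`: the outer vertices `a_i` are encoded
as `(i, false)`, the inner vertices `b_i` as `(i, true)`, with edges
`{a_i, a_{i+1}}`, `{a_i, b_i}`, and `{b_i, b_{i+k}}`. -/
def genPetersen (n k : ℕ) : SimpleGraph (ZMod n × Bool) :=
  SimpleGraph.fromRel (fun p q =>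
    (p.2 = false ∧ q.2 = false ∧ q.1 = p.1 + 1) ∨
    (p.2 = false ∧ q.2 = true ∧ q.1 = p.1) ∨
    (p.2 = true ∧ q.2 = true ∧ q.1 = p.1 + (k : ZMod n)))

theorem dihTau_eq_sr {n : ℕ} (i : ℕ) : (dihTau i : DihedralGroup n) = .sr (-i) := by
  simp [dihTau]

/-- Adjacency in `Ψ_n`: the only edges are `{ρ^i, τ_j}` with `i + j ∈ {0, 1, 3}`;
in Mathlib's notation `sr j` is `τ_{-j}`. -/
theorem psiGraph_adj {n : ℕ} (x y : DihedralGroup n) :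
    (psiGraph n).Adj x y ↔ match x, y with
      | .r i, .sr j => i - j = 0 ∨ i - j = 1 ∨ i - j = 3
      | .sr j, .r i => i - j = 0 ∨ i - j = 1 ∨ i - j = 3
      | _, _ => False := by
  rcases x with i | i <;> rcases y with j | j <;>
    simp [psiGraph, cayley, dihTau_eq_sr] <;> grind

/-- The bijection from `D_8` to the vertices of `GP(8, 3)`. For `i : ZMod 8` the condition
`4 * i = 0` says that `i` is even. -/
def dihedralEquivPetersen : DihedralGroup 8 ≃ ZMod 8 × Bool where
  toFun
    | .r i => if 4 * i = 0 then (i, false) else (i + 2, true)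
    | .sr i => if 4 * i = 0 then (i, true) else (i + 2, false)
  invFun
    | (j, false) => if 4 * j = 0 then .r j else .sr (j - 2)
    | (j, true) => if 4 * j = 0 then .sr j else .r (j - 2)
  left_inv := by rintro (i | i) <;> revert i <;> decide
  right_inv := by rintro ⟨j, _ | _⟩ <;> revert j <;> decide

theorem psi_eight_iso_moebius_kantor :
    Nonempty (psiGraph 8 ≃g genPetersen 8 3) := by
  refine ⟨dihedralEquivPetersen, fun {x y} => ?_⟩
  rw [psiGraph_adj, genPetersen, SimpleGraph.fromRel_adj]
  rcases x with i | i <;> rcases y with j | j <;> revert i j <;> decide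
end
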